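/- Let N ≥ 4, α ∈ ℝ with α ∉ ℤ. There exists a constant C > 0 such that for every φ ∈ C_c^∞(ℝ^N ∖ Σ, ℂ): ∫_{ℝ^N} |∇φ(x)|² dx ≤ C · ∫_{ℝ^N} |(i∇−𝒜)φ(x)|² dx. Moreover the inclusion of the corresponding completions is strict: there exists a function u : ℝ^N → ℝ with ∫_{ℝ^N} |∇u|² dx < ∞ but ∫_{ℝ^N} u(x)²/(x₁²+x₂²) dx = +∞; indeed u(x) = p(x)·|x|^{−(N−1)/2}, where p is a smooth cutoff with p ≡ 0 on B_1(0) and p ≡ 1 on ℝ^N ∖ B_2(0), is such a function. -/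

import Mathlib

open MeasureTheory Complex Filter Metric

/-- the `i`-th coordinate of a point of `ℝ^N` (junk value `0` if `i ≥ N`). -/
noncomputable def coord (N : ℕ) (i : ℕ) (x : EuclideanSpace ℝ (Fin N)) : ℝ :=
  if h : i < N then x ⟨i, h⟩ else 0

/-- the Aharonov–Bohm potential
`𝒜(x) = (−α x₂/(x₁²+x₂²), α x₁/(x₁²+x₂²), 0, …, 0)`. -/
noncomputable def abPot (N : ℕ) (α : ℝ) (x : EuclideanSpace ℝ (Fin N)) :
    EuclideanSpace ℝ (Fin N) :=
  (EuclideanSpace.equiv (Fin N) ℝ).symm fun i =>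
    if (i : ℕ) = 0 then -α * coord N 1 x / (coord N 0 x ^ 2 + coord N 1 x ^ 2)
    else if (i : ℕ) = 1 then α * coord N 0 x / (coord N 0 x ^ 2 + coord N 1 x ^ 2)
    else 0

/-- the singular set `Σ = {x : x₁ = x₂ = 0}` of the Aharonov–Bohm potential. -/
def ABsing (N : ℕ) : Set (EuclideanSpace ℝ (Fin N)) :=
  {x | coord N 0 x = 0 ∧ coord N 1 x = 0}

/-- squared pointwise norm of `(i∇−𝒜)φ(x) = i∇φ(x) − 𝒜(x)φ(x)`. -/
noncomputable def abGrad2 (N : ℕ) (α : ℝ) (φ : EuclideanSpace ℝ (Fin N) → ℂ)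
    (x : EuclideanSpace ℝ (Fin N)) : ℝ :=
  ∑ j : Fin N, ‖Complex.I * fderiv ℝ φ x (EuclideanSpace.single j 1)
      - ((abPot N α x j : ℝ) : ℂ) * φ x‖ ^ 2

/-- `min_{j ∈ ℤ} |j − α|`. -/
noncomputable def minDist (α : ℝ) : ℝ :=
  sInf { t : ℝ | ∃ j : ℤ, t = |(j : ℝ) - α| }

noncomputable def grad2 (N : ℕ) (u : EuclideanSpace ℝ (Fin N) → ℂ)
    (x : EuclideanSpace ℝ (Fin N)) : ℝ :=
  ∑ j : Fin N, ‖fderiv ℝ u x (EuclideanSpace.single j 1)‖ ^ 2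


abbrev EE (n : ℕ) := EuclideanSpace ℝ (Fin (n + 4))

lemma coord_zero (n : ℕ) (x : EE n) : coord (n + 4) 0 x = x 0 := by
  simp [coord]

lemma coord_one (n : ℕ) (x : EE n) : coord (n + 4) 1 x = x 1 := by
  simp [coord]

noncomputable def e0 (n : ℕ) : EE n := EuclideanSpace.single 0 1
noncomputable def e1 (n : ℕ) : EE n := EuclideanSpace.single 1 1

noncomputable def rotA (n : ℕ) (t : ℝ) (x : EE n) : EE n :=
  x + ((Real.cos t - 1) * x 0 - Real.sin t * x 1) • e0 n
    + (Real.sin t * x 0 + (Real.cos t - 1) * x 1) • e1 n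

lemma rotA_zero (n : ℕ) (t : ℝ) (x : EE n) :
    rotA n t x 0 = Real.cos t * x 0 - Real.sin t * x 1 := by
  simp [rotA, e0, e1]; ring

lemma rotA_one (n : ℕ) (t : ℝ) (x : EE n) :
    rotA n t x 1 = Real.sin t * x 0 + Real.cos t * x 1 := by
  simp [rotA, e0, e1]; ring

lemma rotA_ss (n : ℕ) (t : ℝ) (x : EE n) (i : Fin (n + 2)) :
    rotA n t x i.succ.succ = x i.succ.succ := by
  have h1 : i.succ.succ ≠ (1 : Fin (n + 4)) := Fin.succ_succ_ne_one i
  have h0 : i.succ.succ ≠ (0 : Fin (n + 4)) := Fin.succ_ne_zero _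
  simp only [rotA, e0, e1, PiLp.add_apply, PiLp.smul_apply, PiLp.single_apply, if_neg h0,
    if_neg h1, smul_zero, add_zero]

lemma rotA_norm (n : ℕ) (t : ℝ) (x : EE n) : ‖rotA n t x‖ = ‖x‖ := by
  rw [EuclideanSpace.norm_eq, EuclideanSpace.norm_eq]
  congr 1
  rw [Fin.sum_univ_succ, Fin.sum_univ_succ, Fin.sum_univ_succ (n := n + 3),
    Fin.sum_univ_succ (n := n + 2)]
  simp only [Fin.succ_zero_eq_one, rotA_ss, rotA_zero, rotA_one, Real.norm_eq_abs, sq_abs]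
  have := Real.sin_sq_add_cos_sq t
  rw [← add_assoc, ← add_assoc]
  congr 1
  linear_combination (x 0 ^ 2 + x 1 ^ 2) * this

noncomputable def rotL (n : ℕ) (t : ℝ) : EE n →ₗᵢ[ℝ] EE n where
  toFun := rotA n t
  map_add' x y := by
    simp only [rotA, PiLp.add_apply]; module
  map_smul' c x := by
    simp only [rotA, PiLp.smul_apply, smul_eq_mul, RingHom.id_apply]; module
  norm_map' x := rotA_norm n t x

lemma rotA_mp (n : ℕ) (t : ℝ) : MeasurePreserving (rotA n t) volume volume := by
  exact ((rotL n t).toLinearIsometryEquiv rfl).measurePreserving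

lemma rotA_cont (n : ℕ) : Continuous (fun q : ℝ × EE n => rotA n q.1 q.2) := by
  unfold rotA
  fun_prop

lemma rotA_deriv (n : ℕ) (t : ℝ) (x : EE n) :
    HasDerivAt (fun t => rotA n t x)
      ((- rotA n t x 1) • e0 n + (rotA n t x 0) • e1 n) t := by
  rw [rotA_zero, rotA_one]
  have hc := Real.hasDerivAt_cos t
  have hs := Real.hasDerivAt_sin t
  have h1 := (((hc.sub_const 1).mul_const (x 0)).sub (hs.mul_const (x 1))).smul_const (e0 n)
  have h2 := ((hs.mul_const (x 0)).add ((hc.sub_const 1).mul_const (x 1))).smul_const (e1 n)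
  have h3 := (h1.const_add x).add h2
  refine h3.congr_deriv ?_
  module

lemma rotA_r (n : ℕ) (t : ℝ) (x : EE n) :
    rotA n t x 0 ^ 2 + rotA n t x 1 ^ 2 = x 0 ^ 2 + x 1 ^ 2 := by
  rw [rotA_zero, rotA_one]
  linear_combination (x 0 ^ 2 + x 1 ^ 2) * Real.sin_sq_add_cos_sq t

/-- angular magnetic derivative -/
noncomputable def gA (n : ℕ) (α : ℝ) (φ : EE n → ℂ) (x : EE n) : ℂ :=
  Complex.I * fderiv ℝ φ x ((- x 1) • e0 n + (x 0) • e1 n) - α * φ x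

lemma gA_cont (n : ℕ) (α : ℝ) (φ : EE n → ℂ) (h : ContDiff ℝ (⊤ : ℕ∞) φ) :
    Continuous (gA n α φ) := by
  have h1 : Continuous (fderiv ℝ φ) := h.continuous_fderiv (by simp)
  have h2 := h.continuous
  unfold gA
  fun_prop

lemma exp_ne (α : ℝ) (hα : ∀ j : ℤ, (j : ℝ) ≠ α) :
    Complex.exp (2 * Real.pi * α * Complex.I) ≠ 1 := by
  intro h
  rw [Complex.exp_eq_one_iff] at h
  obtain ⟨k, hk⟩ := h
  apply hα k
  have hp : (2 * Real.pi * Complex.I : ℂ) ≠ 0 := Complex.two_pi_I_ne_zero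
  have : (2 * Real.pi * Complex.I : ℂ) * α = (2 * Real.pi * Complex.I : ℂ) * k := by
    linear_combination hk
  have := mul_left_cancel₀ hp this
  exact_mod_cast this.symm

lemma cs_int (f : ℝ → ℝ) (hf : Continuous f) :
    (∫ t in (0:ℝ)..(2 * Real.pi), f t) ^ 2 ≤ 2 * Real.pi * ∫ t in (0:ℝ)..(2 * Real.pi), f t ^ 2 := by
  set L := 2 * Real.pi
  have hL : 0 < L := by positivity
  set m := ∫ t in (0:ℝ)..L, f t
  have h0 : 0 ≤ ∫ t in (0:ℝ)..L, (f t - m / L) ^ 2 :=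
    intervalIntegral.integral_nonneg hL.le (fun t _ => sq_nonneg _)
  have h1 : ∫ t in (0:ℝ)..L, (f t - m / L) ^ 2
      = (∫ t in (0:ℝ)..L, f t ^ 2) - 2 * (m / L) * m + L * (m / L) ^ 2 := by
    have : ∀ t, (f t - m / L) ^ 2 = f t ^ 2 - 2 * (m / L) * f t + (m / L) ^ 2 := by
      intro t; ring
    simp_rw [this]
    rw [intervalIntegral.integral_add, intervalIntegral.integral_sub,
      intervalIntegral.integral_const_mul, intervalIntegral.integral_const]
    · simp [m]
    all_goals apply Continuous.intervalIntegrable; fun_prop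
  rw [h1] at h0
  have h2 : L * ((∫ t in (0:ℝ)..L, f t ^ 2) - 2 * (m / L) * m + L * (m / L) ^ 2)
      = L * (∫ t in (0:ℝ)..L, f t ^ 2) - m ^ 2 := by
    field_simp; ring
  nlinarith [mul_nonneg hL.le h0]

lemma circle (n : ℕ) (α : ℝ) (hα : ∀ j : ℤ, (j : ℝ) ≠ α) (φ : EE n → ℂ)
    (h : ContDiff ℝ (⊤ : ℕ∞) φ) (x : EE n) :
    ‖φ x‖ ^ 2 ≤ 2 * Real.pi / ‖Complex.exp (2 * Real.pi * α * Complex.I) - 1‖ ^ 2 *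
      ∫ t in (0:ℝ)..(2 * Real.pi), ‖gA n α φ (rotA n t x)‖ ^ 2 := by
  set χ : ℝ → ℂ := fun t => Complex.exp (t * α * Complex.I) * φ (rotA n t x)
  have hrc : Continuous (fun t => rotA n t x) :=
    (rotA_cont n).comp (f := fun t => (t, x)) (by fun_prop)
  have hg : Continuous (fun t => gA n α φ (rotA n t x)) := (gA_cont n α φ h).comp hrc
  have hd : ∀ t : ℝ, HasDerivAt χ
      (-Complex.I * Complex.exp (t * α * Complex.I) * gA n α φ (rotA n t x)) t := by
    intro t
    have h1 : HasDerivAt (fun t : ℝ => Complex.exp (t * α * Complex.I))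
        (Complex.exp (t * α * Complex.I) * (α * Complex.I)) t := by
      have : HasDerivAt (fun t : ℝ => (t : ℂ) * α * Complex.I) (α * Complex.I) t := by
        have := ((Complex.ofRealCLM.hasDerivAt (x := t)).mul_const (α : ℂ)).mul_const Complex.I
        simpa using this
      exact this.cexp
    have h2 : HasDerivAt (fun t => φ (rotA n t x)) _ t :=
      (h.differentiable (by simp) (rotA n t x)).hasFDerivAt.comp_hasDerivAt t (rotA_deriv n t x)
    refine (h1.mul h2).congr_deriv ?_
    unfold gA
    linear_combination ((Complex.exp (t * α * Complex.I) * fderiv ℝ φ (rotA n t x)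
      ((- rotA n t x 1) • e0 n + (rotA n t x 0) • e1 n))) * Complex.I_sq
  have hcont : Continuous (fun t : ℝ =>
      -Complex.I * Complex.exp (t * α * Complex.I) * gA n α φ (rotA n t x)) := by fun_prop
  have hftc := intervalIntegral.integral_eq_sub_of_hasDerivAt (a := 0) (b := 2 * Real.pi)
    (fun t _ => hd t) (hcont.intervalIntegrable _ _)
  have h0 : χ 0 = φ x := by simp [χ, rotA]
  have h1 : χ (2 * Real.pi) = Complex.exp (2 * Real.pi * α * Complex.I) * φ x := by
    simp [χ, rotA]
  rw [h0, h1] at hftc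
  have hn : ‖Complex.exp (2 * Real.pi * α * Complex.I) - 1‖ * ‖φ x‖
      ≤ ∫ t in (0:ℝ)..(2 * Real.pi), ‖gA n α φ (rotA n t x)‖ := by
    rw [← norm_mul, sub_mul, one_mul, ← hftc]
    refine (intervalIntegral.norm_integral_le_integral_norm (by positivity)).trans (le_of_eq ?_)
    congr 1
    ext t
    rw [norm_mul, norm_mul, norm_neg, Complex.norm_I, ← Complex.ofReal_mul,
      Complex.norm_exp_ofReal_mul_I]
    ring
  have hk : 0 < ‖Complex.exp (2 * Real.pi * α * Complex.I) - 1‖ :=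
    norm_pos_iff.2 (sub_ne_zero.2 (exp_ne α hα))
  have hcs := cs_int _ hg.norm
  have hsq := pow_le_pow_left₀ (by positivity) hn 2
  rw [div_mul_eq_mul_div, le_div_iff₀ (by positivity)]
  nlinarith


noncomputable def GA (n : ℕ) (α : ℝ) (φ : EE n → ℂ) (x : EE n) : ℝ :=
  ‖gA n α φ x‖ ^ 2 / (x 0 ^ 2 + x 1 ^ 2)

lemma GA_meas (n : ℕ) (α : ℝ) (φ : EE n → ℂ) (h : ContDiff ℝ (⊤ : ℕ∞) φ) :
    Measurable (GA n α φ) := by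
  unfold GA
  have h1 := (gA_cont n α φ h).norm.pow 2
  have h2 : Continuous (fun x : EE n => x 0 ^ 2 + x 1 ^ 2) := by fun_prop
  exact h1.measurable.div h2.measurable

lemma hardy (n : ℕ) (α : ℝ) (hα : ∀ j : ℤ, (j : ℝ) ≠ α) : ∃ K : ℝ, 0 ≤ K ∧
    ∀ φ : EE n → ℂ, ContDiff ℝ (⊤ : ℕ∞) φ →
    ∫⁻ x, ENNReal.ofReal (‖φ x‖ ^ 2 / (x 0 ^ 2 + x 1 ^ 2)) ≤
      ENNReal.ofReal K * ∫⁻ x, ENNReal.ofReal (GA n α φ x) := by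
  set K := 2 * Real.pi / ‖Complex.exp (2 * Real.pi * α * Complex.I) - 1‖ ^ 2 with hK
  have hK0 : 0 ≤ K := by positivity
  refine ⟨K * (2 * Real.pi), by positivity, fun φ h => ?_⟩
  have hpt : ∀ x, ENNReal.ofReal (‖φ x‖ ^ 2 / (x 0 ^ 2 + x 1 ^ 2)) ≤
      ENNReal.ofReal K *
        ∫⁻ t in Set.Ioc 0 (2 * Real.pi), ENNReal.ofReal (GA n α φ (rotA n t x)) := by
    intro x
    have hrc : Continuous (fun t => rotA n t x) :=
      (rotA_cont n).comp (f := fun t => (t, x)) (by fun_prop)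
    have hg : Continuous (fun t => gA n α φ (rotA n t x)) := (gA_cont n α φ h).comp hrc
    have hG : ∀ t, GA n α φ (rotA n t x)
        = ‖gA n α φ (rotA n t x)‖ ^ 2 / (x 0 ^ 2 + x 1 ^ 2) := by
      intro t; simp only [GA, rotA_r]
    simp_rw [hG]
    rw [← ofReal_integral_eq_lintegral_ofReal, ← ENNReal.ofReal_mul hK0,
      ← intervalIntegral.integral_of_le (by positivity), intervalIntegral.integral_div,
      ← mul_div_assoc]
    · apply ENNReal.ofReal_le_ofReal
      gcongr
      exact circle n α hα φ h x
    · have hc : Continuous fun t => ‖gA n α φ (rotA n t x)‖ ^ 2 / (x 0 ^ 2 + x 1 ^ 2) :=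
        (hg.norm.pow 2).div_const _
      exact hc.integrableOn_Ioc
    · exact Filter.Eventually.of_forall fun t => by positivity
  calc _ ≤ ∫⁻ x, ENNReal.ofReal K *
        ∫⁻ t in Set.Ioc 0 (2 * Real.pi), ENNReal.ofReal (GA n α φ (rotA n t x)) :=
        lintegral_mono hpt
    _ = ENNReal.ofReal K * ∫⁻ x : EE n,
        ∫⁻ t in Set.Ioc 0 (2 * Real.pi), ENNReal.ofReal (GA n α φ (rotA n t x)) :=
        lintegral_const_mul' _ _ ENNReal.ofReal_ne_top
    _ = ENNReal.ofReal K * ∫⁻ t in Set.Ioc 0 (2 * Real.pi),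
          ∫⁻ x : EE n, ENNReal.ofReal (GA n α φ (rotA n t x)) := by
        rw [lintegral_lintegral_swap]
        apply Measurable.aemeasurable
        apply ENNReal.measurable_ofReal.comp
        apply (GA_meas n α φ h).comp
        exact ((rotA_cont n).comp continuous_swap).measurable
    _ = ENNReal.ofReal K * ∫⁻ t in Set.Ioc 0 (2 * Real.pi),
          ∫⁻ x : EE n, ENNReal.ofReal (GA n α φ x) := by
        congr 1
        apply lintegral_congr
        intro t
        exact (rotA_mp n t).lintegral_comp
          (ENNReal.measurable_ofReal.comp (GA_meas n α φ h))
    _ = _ := by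
        rw [lintegral_const, ENNReal.ofReal_mul hK0]
        simp only [Measure.restrict_apply_univ, Real.volume_Ioc, sub_zero]
        ring

lemma abPot0 (n : ℕ) (α : ℝ) (x : EE n) :
    abPot (n + 4) α x 0 = -α * x 1 / (x 0 ^ 2 + x 1 ^ 2) := by
  simp [abPot, coord_zero, coord_one]

lemma abPot1 (n : ℕ) (α : ℝ) (x : EE n) :
    abPot (n + 4) α x 1 = α * x 0 / (x 0 ^ 2 + x 1 ^ 2) := by
  simp [abPot, coord_zero, coord_one]

lemma abPotss (n : ℕ) (α : ℝ) (x : EE n) (i : Fin (n + 2)) :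
    abPot (n + 4) α x i.succ.succ = 0 := by
  simp [abPot]

lemma GA_le (n : ℕ) (α : ℝ) (φ : EE n → ℂ) (x : EE n) :
    GA n α φ x ≤ abGrad2 (n + 4) α φ x := by
  have hnn : 0 ≤ abGrad2 (n + 4) α φ x := Finset.sum_nonneg fun i _ => by positivity
  rcases eq_or_ne (x 0 ^ 2 + x 1 ^ 2) 0 with h0 | h0
  · rw [GA, h0, div_zero]; exact hnn
  have hr : 0 < x 0 ^ 2 + x 1 ^ 2 := lt_of_le_of_ne (by positivity) h0.symm
  rw [GA, div_le_iff₀ hr]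
  have hsum : ‖Complex.I * fderiv ℝ φ x (e0 n) - ((abPot (n + 4) α x 0 : ℝ) : ℂ) * φ x‖ ^ 2
      + ‖Complex.I * fderiv ℝ φ x (e1 n) - ((abPot (n + 4) α x 1 : ℝ) : ℂ) * φ x‖ ^ 2
      ≤ abGrad2 (n + 4) α φ x := by
    rw [abGrad2, Fin.sum_univ_succ, Fin.sum_univ_succ, ← add_assoc]
    refine le_add_of_nonneg_right (Finset.sum_nonneg fun i _ => by positivity)
  set a := Complex.I * fderiv ℝ φ x (e0 n) - ((abPot (n + 4) α x 0 : ℝ) : ℂ) * φ x with ha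
  set b := Complex.I * fderiv ℝ φ x (e1 n) - ((abPot (n + 4) α x 1 : ℝ) : ℂ) * φ x with hb
  have hg : gA n α φ x = -(x 1 : ℂ) * a + (x 0 : ℂ) * b := by
    have hrc : ((x 0 : ℂ) ^ 2 + (x 1 : ℂ) ^ 2) ≠ 0 := by
      rw [← Complex.ofReal_pow, ← Complex.ofReal_pow, ← Complex.ofReal_add]
      exact Complex.ofReal_ne_zero.2 h0
    rw [ha, hb, abPot0, abPot1, gA, map_add, map_smul, map_smul]
    simp only [Complex.real_smul]
    push_cast
    field_simp
    ring
  have hle : ‖gA n α φ x‖ ≤ |x 1| * ‖a‖ + |x 0| * ‖b‖ := by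
    rw [hg]
    refine (norm_add_le _ _).trans (le_of_eq ?_)
    simp
  have hsq := pow_le_pow_left₀ (norm_nonneg _) hle 2
  have h1 := sq_abs (x 0)
  have h2 := sq_abs (x 1)
  nlinarith [sq_nonneg (|x 1| * ‖b‖ - |x 0| * ‖a‖), mul_le_mul_of_nonneg_right hsum hr.le]

lemma grad2_le (n : ℕ) (α : ℝ) (φ : EE n → ℂ) (x : EE n) :
    grad2 (n + 4) φ x ≤ 2 * abGrad2 (n + 4) α φ x
      + 2 * α ^ 2 * (‖φ x‖ ^ 2 / (x 0 ^ 2 + x 1 ^ 2)) := by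
  have h1 : grad2 (n + 4) φ x ≤ ∑ j : Fin (n + 4),
      (2 * ‖Complex.I * fderiv ℝ φ x (EuclideanSpace.single j 1)
      - ((abPot (n + 4) α x j : ℝ) : ℂ) * φ x‖ ^ 2 + 2 * ‖φ x‖ ^ 2 * abPot (n + 4) α x j ^ 2) := by
    apply Finset.sum_le_sum
    intro j _
    have h := norm_add_le (Complex.I * fderiv ℝ φ x (EuclideanSpace.single j 1)
      - ((abPot (n + 4) α x j : ℝ) : ℂ) * φ x) (((abPot (n + 4) α x j : ℝ) : ℂ) * φ x)
    rw [sub_add_cancel, norm_mul, Complex.norm_I, one_mul, norm_mul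
      ((abPot (n + 4) α x j : ℝ) : ℂ), Complex.norm_real, Real.norm_eq_abs] at h
    have h2 := pow_le_pow_left₀ (norm_nonneg _) h 2
    rw [← sq_abs (abPot (n + 4) α x j)]
    set p := ‖Complex.I * fderiv ℝ φ x (EuclideanSpace.single j 1)
      - ((abPot (n + 4) α x j : ℝ) : ℂ) * φ x‖
    set q := |abPot (n + 4) α x j| with hq
    nlinarith [sq_nonneg (p - q * ‖φ x‖)]
  refine h1.trans (le_of_eq ?_)
  rw [Finset.sum_add_distrib, ← Finset.mul_sum, ← Finset.mul_sum, ← abGrad2]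
  congr 1
  rw [Fin.sum_univ_succ, Fin.sum_univ_succ]
  simp only [abPotss, Fin.succ_zero_eq_one, abPot0, abPot1]
  rcases eq_or_ne (x 0 ^ 2 + x 1 ^ 2) 0 with h0 | h0
  · simp [h0]
  · simp only [ne_eq, OfNat.ofNat_ne_zero, not_false_eq_true, zero_pow, Finset.sum_const_zero]
    field_simp
    ring

lemma abPot_cont (n : ℕ) (α : ℝ) (φ : EE n → ℂ) (hφ : Continuous φ)
    (hd : Disjoint (tsupport φ) (ABsing (n + 4))) (j : Fin (n + 4)) :
    Continuous fun x => ((abPot (n + 4) α x j : ℝ) : ℂ) * φ x := by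
  rw [continuous_iff_continuousAt]
  intro x
  by_cases hx : x ∈ tsupport φ
  · have hs := Set.disjoint_left.1 hd hx
    have h0 : x 0 ^ 2 + x 1 ^ 2 ≠ 0 := by
      intro h
      apply hs
      have e0 : x 0 = 0 := by nlinarith [sq_nonneg (x 0), sq_nonneg (x 1)]
      have e1 : x 1 = 0 := by nlinarith [sq_nonneg (x 0), sq_nonneg (x 1)]
      exact ⟨by rw [coord_zero, e0], by rw [coord_one, e1]⟩
    refine ContinuousAt.mul (Complex.continuous_ofReal.continuousAt.comp ?_) hφ.continuousAt
    refine Fin.cases ?_ (fun i => Fin.cases ?_ (fun i => ?_) i) j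
    · simp only [abPot0]
      exact ContinuousAt.div (by fun_prop) (by fun_prop) h0
    · simp only [Fin.succ_zero_eq_one, abPot1]
      exact ContinuousAt.div (by fun_prop) (by fun_prop) h0
    · simp only [abPotss]
      exact continuousAt_const
  · have : (fun x => ((abPot (n + 4) α x j : ℝ) : ℂ) * φ x) =ᶠ[nhds x] fun _ => 0 := by
      filter_upwards [notMem_tsupport_iff_eventuallyEq.1 hx] with y hy
      simp [hy]
    exact continuousAt_const.congr this.symm

lemma part1 (n : ℕ) (α : ℝ) (hα : ∀ j : ℤ, (j : ℝ) ≠ α) :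
    ∃ C : ℝ, 0 < C ∧
      ∀ φ : EE n → ℂ, ContDiff ℝ (⊤ : ℕ∞) φ → HasCompactSupport φ →
        Disjoint (tsupport φ) (ABsing (n + 4)) →
        (∫ x, grad2 (n + 4) φ x) ≤ C * ∫ x, abGrad2 (n + 4) α φ x := by
  obtain ⟨K, hK0, hK⟩ := hardy n α hα
  refine ⟨2 + 2 * α ^ 2 * K, by positivity, fun φ h hc hd => ?_⟩
  have hf : Continuous (fderiv ℝ φ) := h.continuous_fderiv (by simp)
  have hAc : Continuous (abGrad2 (n + 4) α φ) := by
    unfold abGrad2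
    refine continuous_finsetSum _ fun j _ => ?_
    have h1 := abPot_cont n α φ h.continuous hd j
    have h2 : Continuous fun x => fderiv ℝ φ x (EuclideanSpace.single j 1) :=
      hf.clm_apply continuous_const
    exact (((continuous_const.mul h2).sub h1).norm).pow 2
  have hGc : Continuous (grad2 (n + 4) φ) := by
    unfold grad2
    exact continuous_finsetSum _ fun j _ => ((hf.clm_apply continuous_const).norm).pow 2
  have hAs : HasCompactSupport (abGrad2 (n + 4) α φ) := by
    refine HasCompactSupport.intro hc fun x hx => ?_
    have h1 : fderiv ℝ φ x = 0 := by
      by_contra hne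
      exact hx (support_fderiv_subset ℝ hne)
    simp [abGrad2, h1, image_eq_zero_of_notMem_tsupport hx]
  have hAi : Integrable (abGrad2 (n + 4) α φ) := hAc.integrable_of_hasCompactSupport hAs
  have hAn : ∀ x, 0 ≤ abGrad2 (n + 4) α φ x := fun x => Finset.sum_nonneg fun i _ => by positivity
  have hGn : ∀ x, 0 ≤ grad2 (n + 4) φ x := fun x => Finset.sum_nonneg fun i _ => by positivity
  have key : ∫⁻ x, ENNReal.ofReal (grad2 (n + 4) φ x) ≤
      ENNReal.ofReal (2 + 2 * α ^ 2 * K) * ∫⁻ x, ENNReal.ofReal (abGrad2 (n + 4) α φ x) := by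
    calc ∫⁻ x, ENNReal.ofReal (grad2 (n + 4) φ x) ≤
        ∫⁻ x, (ENNReal.ofReal 2 * ENNReal.ofReal (abGrad2 (n + 4) α φ x)
          + ENNReal.ofReal (2 * α ^ 2) * ENNReal.ofReal (‖φ x‖ ^ 2 / (x 0 ^ 2 + x 1 ^ 2))) := by
          apply lintegral_mono
          intro x
          beta_reduce
          rw [← ENNReal.ofReal_mul (by positivity), ← ENNReal.ofReal_mul (by positivity),
            ← ENNReal.ofReal_add (mul_nonneg (by positivity) (hAn x)) (by positivity)]
          exact ENNReal.ofReal_le_ofReal (grad2_le n α φ x)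
      _ = ENNReal.ofReal 2 * (∫⁻ x, ENNReal.ofReal (abGrad2 (n + 4) α φ x))
          + ENNReal.ofReal (2 * α ^ 2) *
            ∫⁻ x, ENNReal.ofReal (‖φ x‖ ^ 2 / (x 0 ^ 2 + x 1 ^ 2)) := by
          rw [lintegral_add_left, lintegral_const_mul' _ _ ENNReal.ofReal_ne_top,
            lintegral_const_mul' _ _ ENNReal.ofReal_ne_top]
          exact (ENNReal.measurable_ofReal.comp hAc.measurable).const_mul _
      _ ≤ ENNReal.ofReal 2 * (∫⁻ x, ENNReal.ofReal (abGrad2 (n + 4) α φ x))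
          + ENNReal.ofReal (2 * α ^ 2) *
            (ENNReal.ofReal K * ∫⁻ x, ENNReal.ofReal (abGrad2 (n + 4) α φ x)) := by
          gcongr
          refine (hK φ h).trans ?_
          gcongr
          exact GA_le n α φ _
      _ = _ := by
          rw [ENNReal.ofReal_add (by positivity) (by positivity),
            ENNReal.ofReal_mul (p := 2 * α ^ 2) (by positivity)]
          ring
  rw [integral_eq_lintegral_of_nonneg_ae (Filter.Eventually.of_forall hGn)
    hGc.aestronglyMeasurable]
  refine ENNReal.toReal_le_of_le_ofReal
    (mul_nonneg (by positivity) (integral_nonneg hAn)) ?_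
  rw [ENNReal.ofReal_mul (by positivity),
    ofReal_integral_eq_lintegral_ofReal hAi (Filter.Eventually.of_forall hAn)]
  exact key


lemma cutoff (n : ℕ) : ∃ p : EE n → ℝ, ContDiff ℝ (⊤ : ℕ∞) p ∧
      (∀ x ∈ Metric.ball (0 : EE n) 1, p x = 0) ∧
      (∀ x ∉ Metric.ball (0 : EE n) 2, p x = 1) := by
  let f : ContDiffBump (0 : EE n) := ⟨1, 2, one_pos, one_lt_two⟩
  refine ⟨fun x => 1 - f x, contDiff_const.sub f.contDiff, fun x hx => ?_, fun x hx => ?_⟩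
  · have := f.one_of_mem_closedBall (x := x) (Metric.ball_subset_closedBall hx)
    simp [this]
  · have : f x = 0 := by
      rw [← Function.notMem_support, f.support_eq]
      exact hx
    simp [this]

lemma fin_part (n : ℕ) (p : EE n → ℝ) (hp : ContDiff ℝ (⊤ : ℕ∞) p)
    (h0 : ∀ x ∈ Metric.ball (0 : EE n) 1, p x = 0)
    (h1 : ∀ x ∉ Metric.ball (0 : EE n) 2, p x = 1) (s : ℝ)
    (hs : s = (((n + 4 : ℕ) : ℝ) - 1) / 2) :
    ∫⁻ x, ENNReal.ofReal (‖fderiv ℝ (fun y : EE n => p y * ‖y‖ ^ (-s)) x‖ ^ 2) < ⊤ := by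
  have hspos : 0 < s := by rw [hs]; push_cast; linarith [(n.cast_nonneg : (0:ℝ) ≤ n)]
  set u := fun y : EE n => p y * ‖y‖ ^ (-s) with hu
  have hsm : ContDiff ℝ 1 u := by
    rw [contDiff_iff_contDiffAt]
    intro x
    by_cases hx : x = 0
    · have : u =ᶠ[nhds x] fun _ => 0 := by
        rw [hx]
        filter_upwards [Metric.ball_mem_nhds (0 : EE n) one_pos] with y hy
        simp [hu, h0 y hy]
      exact contDiffAt_const.congr_of_eventuallyEq this
    · refine (hp.contDiffAt.of_le (by simp)).mul ?_
      exact (contDiffAt_norm ℝ hx).rpow_const_of_ne (norm_ne_zero_iff.2 hx)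
  have hc : Continuous (fderiv ℝ u) := hsm.continuous_fderiv (by simp)
  obtain ⟨M, hM⟩ := (isCompact_closedBall (0 : EE n) 2).exists_bound_of_continuousOn
    hc.continuousOn
  have hout : ∀ x : EE n, 2 < ‖x‖ → ‖fderiv ℝ u x‖ ≤ s * ‖x‖ ^ (-s - 1) := by
    intro x hx
    have hx0 : x ≠ 0 := by rintro rfl; simp at hx; linarith
    have he : u =ᶠ[nhds x] fun y => ‖y‖ ^ (-s) := by
      have : {y : EE n | 2 < ‖y‖} ∈ nhds x :=
        (isOpen_lt continuous_const continuous_norm).mem_nhds hx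
      filter_upwards [this] with y hy
      have : p y = 1 := h1 y (by simp; exact le_of_lt hy)
      simp [hu, this]
    have hn : HasFDerivAt (fun y : EE n => ‖y‖) (fderiv ℝ (fun y : EE n => ‖y‖) x) x :=
      ((contDiffAt_norm ℝ hx0 (n := 1)).differentiableAt (by simp)).hasFDerivAt
    have hr := Real.hasDerivAt_rpow_const (x := ‖x‖) (p := -s) (Or.inl (norm_ne_zero_iff.2 hx0))
    have hcomp := hr.comp_hasFDerivAt x hn
    have hfd : fderiv ℝ (fun y : EE n => ‖y‖ ^ (-s)) x = _ := hcomp.fderiv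
    rw [he.fderiv_eq, hfd, norm_smul, norm_mul, norm_neg, Real.norm_of_nonneg hspos.le,
      Real.norm_of_nonneg (by positivity)]
    refine mul_le_of_le_one_right (by positivity) ?_
    have := norm_fderiv_le_of_lipschitz ℝ (lipschitzWith_one_norm (E := EE n)) (x₀ := x)
    simpa using this
  set C := max (M ^ 2 * 3 ^ (2 * s + 2)) (s ^ 2 * 2 ^ (2 * s + 2)) with hC
  have hC0 : 0 ≤ C := le_max_of_le_left (by positivity)
  have hb : ∀ x : EE n, ‖fderiv ℝ u x‖ ^ 2 ≤ C * (1 + ‖x‖) ^ (-(2 * s + 2)) := by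
    intro x
    have hpos : 0 < 1 + ‖x‖ := by positivity
    rw [Real.rpow_neg hpos.le, ← div_eq_mul_inv, le_div_iff₀ (by positivity)]
    rcases le_or_gt ‖x‖ 2 with hx | hx
    · refine le_trans ?_ (le_max_left _ _)
      gcongr
      · exact hM x (by simpa using hx)
      · linarith
    · refine le_trans ?_ (le_max_right _ _)
      have hxp : 0 < ‖x‖ := by linarith
      have e1 : (1 + ‖x‖) ^ (2 * s + 2) ≤ 2 ^ (2 * s + 2) * ‖x‖ ^ (2 * s + 2) := by
        rw [← Real.mul_rpow (by norm_num) hxp.le]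
        gcongr
        linarith
      have e2 : (‖x‖ ^ (-s - 1)) ^ 2 * ‖x‖ ^ (2 * s + 2) = 1 := by
        rw [← Real.rpow_natCast, ← Real.rpow_mul hxp.le, ← Real.rpow_add hxp]
        norm_num
        ring_nf
        simp
      calc ‖fderiv ℝ u x‖ ^ 2 * (1 + ‖x‖) ^ (2 * s + 2)
          ≤ (s * ‖x‖ ^ (-s - 1)) ^ 2 * (2 ^ (2 * s + 2) * ‖x‖ ^ (2 * s + 2)) := by
            gcongr
            exact hout x hx
        _ = s ^ 2 * 2 ^ (2 * s + 2) * ((‖x‖ ^ (-s - 1)) ^ 2 * ‖x‖ ^ (2 * s + 2)) := by ring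
        _ = _ := by rw [e2, mul_one]
  calc _ ≤ ∫⁻ x : EE n, ENNReal.ofReal C * ENNReal.ofReal ((1 + ‖x‖) ^ (-(2 * s + 2))) := by
        apply lintegral_mono
        intro x
        beta_reduce
        rw [← ENNReal.ofReal_mul hC0]
        exact ENNReal.ofReal_le_ofReal (hb x)
    _ = ENNReal.ofReal C * ∫⁻ x : EE n, ENNReal.ofReal ((1 + ‖x‖) ^ (-(2 * s + 2))) :=
        lintegral_const_mul' _ _ ENNReal.ofReal_ne_top
    _ < ⊤ := by
        refine ENNReal.mul_lt_top ENNReal.ofReal_lt_top (finite_integral_one_add_norm ?_)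
        rw [finrank_euclideanSpace_fin, hs]
        linarith

/-- the dyadic boxes -/
noncomputable def loB (n k : ℕ) : Fin (n + 4) → ℝ :=
  Fin.cons ((1 / 2 : ℝ) ^ (k + 1)) (Fin.cons 0 fun _ => 2)
noncomputable def hiB (n k : ℕ) : Fin (n + 4) → ℝ :=
  Fin.cons ((1 / 2 : ℝ) ^ k) (Fin.cons ((1 / 2 : ℝ) ^ k) fun _ => 3)

def boxB (n k : ℕ) : Set (EE n) :=
  {x | ∀ i, x i ∈ Set.Ioc (loB n k i) (hiB n k i)}

lemma boxB_eq (n k : ℕ) : boxB n k = (MeasurableEquiv.toLp 2 (Fin (n + 4) → ℝ)).symm ⁻¹'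
    (Set.univ.pi fun i => Set.Ioc (loB n k i) (hiB n k i)) := by
  ext x; simp [boxB]

lemma boxB_meas (n k : ℕ) : MeasurableSet (boxB n k) := by
  rw [boxB_eq]
  exact (MeasurableEquiv.measurable _) (MeasurableSet.univ_pi fun i => measurableSet_Ioc)

lemma boxB_vol (n k : ℕ) : volume (boxB n k) = ENNReal.ofReal ((1 / 4 : ℝ) ^ k / 2) := by
  rw [boxB_eq, (EuclideanSpace.volume_preserving_symm_measurableEquiv_toLp
    (Fin (n + 4))).measure_preimage_equiv, Real.volume_pi_Ioc,
    Fin.prod_univ_succ, Fin.prod_univ_succ]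
  simp only [loB, hiB, Fin.cons_zero, Fin.cons_succ]
  have h32 : (3:ℝ) - 2 = 1 := by norm_num
  have hnn : 0 ≤ (1 / 2 : ℝ) ^ k - (1 / 2) ^ (k + 1) := by
    rw [pow_succ]
    have : 0 < (1 / 2 : ℝ) ^ k := by positivity
    linarith
  rw [h32, ENNReal.ofReal_one, Finset.prod_const_one, mul_one, sub_zero,
    ← ENNReal.ofReal_mul hnn]
  congr 1
  rw [pow_succ, show (1 / 4 : ℝ) = (1 / 2) * (1 / 2) by norm_num, mul_pow]
  ring

lemma inf_part (n : ℕ) (p : EE n → ℝ)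
    (h1 : ∀ x ∉ Metric.ball (0 : EE n) 2, p x = 1) (s : ℝ) (hs : 0 < s) :
    ∫⁻ x : EE n, ENNReal.ofReal ((p x * ‖x‖ ^ (-s)) ^ 2 / (x 0 ^ 2 + x 1 ^ 2)) = ⊤ := by
  set R : ℝ := 3 * ((n : ℝ) + 4) with hR
  have hR0 : 0 < R := by positivity
  set c : ℝ := (R ^ (-s)) ^ 2 / 4 with hc
  have hc0 : 0 < c := by positivity
  have hpt : ∀ k, ∀ x ∈ boxB n k,
      2 * c * 4 ^ k ≤ (p x * ‖x‖ ^ (-s)) ^ 2 / (x 0 ^ 2 + x 1 ^ 2) := by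
    intro k x hx
    have hx0 := hx 0
    have hx1 := hx 1
    have hx2 := hx (Fin.succ (Fin.succ 0))
    have hk : (0:ℝ) < (1 / 2) ^ (k + 1) := by positivity
    have hk1 : ((1:ℝ) / 2) ^ k ≤ 1 := pow_le_one₀ (by norm_num) (by norm_num)
    have e1 : (1 : Fin (n + 4)) = Fin.succ 0 := rfl
    simp only [loB, hiB, Fin.cons_zero, Fin.cons_succ, e1] at hx0 hx1 hx2
    rw [← e1] at hx1
    have hall : ∀ i, |x i| ≤ 3 := by
      intro i
      refine Fin.cases ?_ (fun i => Fin.cases ?_ (fun i => ?_) i) i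
      · rw [abs_le]; constructor <;> linarith [hx0.1, hx0.2]
      · rw [← e1, abs_le]; constructor <;> linarith [hx1.1, hx1.2]
      · have := hx i.succ.succ
        simp only [loB, hiB, Fin.cons_succ] at this
        rw [abs_le]; constructor <;> linarith [this.1, this.2]
    have hlow : 2 ≤ ‖x‖ := by
      have := PiLp.norm_apply_le x (Fin.succ (Fin.succ 0))
      rw [Real.norm_eq_abs] at this
      linarith [hx2.1, le_abs_self (x (Fin.succ (Fin.succ 0)))]
    have hup : ‖x‖ ≤ R := by
      rw [EuclideanSpace.norm_eq]
      apply Real.sqrt_le_iff.2 ⟨hR0.le, ?_⟩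
      calc ∑ i, ‖x i‖ ^ 2 ≤ ∑ i : Fin (n + 4), (3:ℝ) ^ 2 := by
            apply Finset.sum_le_sum
            intro i _
            rw [Real.norm_eq_abs]
            exact pow_le_pow_left₀ (abs_nonneg _) (hall i) 2
        _ = ((n : ℝ) + 4) * 9 := by
            rw [Finset.sum_const, Finset.card_univ, Fintype.card_fin, nsmul_eq_mul]
            push_cast; ring
        _ ≤ R ^ 2 := by rw [hR]; nlinarith [(n.cast_nonneg : (0:ℝ) ≤ n)]
    have hp1 : p x = 1 := h1 x (by simpa using hlow)
    rw [hp1, one_mul]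
    have hmono : R ^ (-s) ≤ ‖x‖ ^ (-s) :=
      Real.rpow_le_rpow_of_nonpos (by linarith) hup (by linarith)
    have hsq : (R ^ (-s)) ^ 2 ≤ (‖x‖ ^ (-s)) ^ 2 := pow_le_pow_left₀ (by positivity) hmono 2
    have hr0 : 0 < x 0 ^ 2 + x 1 ^ 2 := by
      have : 0 < x 0 := by linarith [hx0.1]
      positivity
    have h44 : ((1:ℝ) / 2) ^ k * (1 / 2) ^ k * 4 ^ k = 1 := by
      rw [← mul_pow, ← mul_pow]; norm_num
    have hr1 : x 0 ^ 2 + x 1 ^ 2 ≤ 2 * ((1 / 2) ^ k * (1 / 2) ^ k) := by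
      have a0 : 0 ≤ x 0 := by linarith [hx0.1]
      have a1 : 0 ≤ x 1 := by linarith [hx1.1]
      nlinarith [hx0.2, hx1.2]
    rw [le_div_iff₀ hr0]
    calc 2 * c * 4 ^ k * (x 0 ^ 2 + x 1 ^ 2)
        ≤ 2 * c * 4 ^ k * (2 * ((1 / 2) ^ k * (1 / 2) ^ k)) := by gcongr
      _ = 4 * c * ((1 / 2) ^ k * (1 / 2) ^ k * 4 ^ k) := by ring
      _ = (R ^ (-s)) ^ 2 := by rw [h44, hc]; ring
      _ ≤ _ := hsq
  have hdisj : Pairwise (Function.onFun Disjoint (boxB n)) := by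
    have hanti : Antitone (fun k : ℕ => ((1:ℝ) / 2) ^ k) :=
      pow_right_anti₀ (by norm_num) (by norm_num)
    intro i j hij
    have := hanti.pairwise_disjoint_on_Ioc_succ hij
    rw [Function.onFun, Set.disjoint_left] at this ⊢
    intro x hxi hxj
    have hi := hxi 0
    have hj := hxj 0
    simp only [loB, hiB, Fin.cons_zero] at hi hj
    exact this hi hj
  rw [eq_top_iff]
  calc (⊤ : ENNReal) = ∑' _ : ℕ, ENNReal.ofReal c :=
        (ENNReal.tsum_const_eq_top_of_ne_zero (by simpa using hc0)).symm
    _ ≤ ∑' k, ∫⁻ x in boxB n k,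
          ENNReal.ofReal ((p x * ‖x‖ ^ (-s)) ^ 2 / (x 0 ^ 2 + x 1 ^ 2)) := by
        apply ENNReal.tsum_le_tsum
        intro k
        calc ENNReal.ofReal c = ENNReal.ofReal (2 * c * 4 ^ k) * volume (boxB n k) := by
              rw [boxB_vol, ← ENNReal.ofReal_mul (by positivity)]
              congr 1
              have : (4:ℝ) ^ k * (1 / 4) ^ k = 1 := by rw [← mul_pow]; norm_num
              linear_combination (-c) * this
          _ = ∫⁻ x in boxB n k, ENNReal.ofReal (2 * c * 4 ^ k) := by
              rw [setLIntegral_const]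
          _ ≤ _ := setLIntegral_mono' (boxB_meas n k)
              fun x hx => ENNReal.ofReal_le_ofReal (hpt k x hx)
    _ = ∫⁻ x in ⋃ k, boxB n k,
          ENNReal.ofReal ((p x * ‖x‖ ^ (-s)) ^ 2 / (x 0 ^ 2 + x 1 ^ 2)) :=
        (lintegral_iUnion (boxB_meas n) hdisj _).symm
    _ ≤ _ := setLIntegral_le_lintegral _ _

/-- for non-integer circulation `α` the Dirichlet form is controlled by
the Aharonov–Bohm form on `C_c^∞(ℝ^N∖Σ)`, but the inclusion of the completions is
strict: `u = p(x)|x|^{−(N−1)/2}` has finite Dirichlet integral and infinite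
Hardy integral. -/
theorem stmt_18 (N : ℕ) (hN : 4 ≤ N) (α : ℝ) (hα : ∀ j : ℤ, (j : ℝ) ≠ α) :
    (∃ C : ℝ, 0 < C ∧
      ∀ φ : EuclideanSpace ℝ (Fin N) → ℂ, ContDiff ℝ (⊤ : ℕ∞) φ → HasCompactSupport φ →
        Disjoint (tsupport φ) (ABsing N) →
        (∫ x, grad2 N φ x) ≤ C * ∫ x, abGrad2 N α φ x) ∧
    (∃ p : EuclideanSpace ℝ (Fin N) → ℝ, ContDiff ℝ (⊤ : ℕ∞) p ∧
      (∀ x ∈ Metric.ball (0 : EuclideanSpace ℝ (Fin N)) 1, p x = 0) ∧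
      (∀ x ∉ Metric.ball (0 : EuclideanSpace ℝ (Fin N)) 2, p x = 1) ∧
      (∫⁻ x, ENNReal.ofReal
          (‖fderiv ℝ (fun y : EuclideanSpace ℝ (Fin N) =>
            p y * ‖y‖ ^ (-(((N : ℝ) - 1) / 2))) x‖ ^ 2) < ⊤) ∧
      (∫⁻ x, ENNReal.ofReal
          ((p x * ‖x‖ ^ (-(((N : ℝ) - 1) / 2))) ^ 2 /
            (coord N 0 x ^ 2 + coord N 1 x ^ 2)) = ⊤)) := by
  obtain ⟨n, rfl⟩ : ∃ n, N = n + 4 := ⟨N - 4, by omega⟩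
  refine ⟨part1 n α hα, ?_⟩
  obtain ⟨p, hp, h0, h1⟩ := cutoff n
  refine ⟨p, hp, h0, h1, fin_part n p hp h0 h1 _ rfl, ?_⟩
  have hs : 0 < (((n + 4 : ℕ) : ℝ) - 1) / 2 := by
    push_cast; linarith [(n.cast_nonneg : (0:ℝ) ≤ n)]
  simp only [coord_zero, coord_one]
  exact inf_part n p h1 _ hs
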